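/- Let G ≤ Sym(Ω) be a semiprimitive permutation group with a non-regular plinth K (i.e. K_ω ≠ 1 for some ω ∈ Ω). Then: (i) K is the unique plinth of G; (ii) K is perfect, i.e. [K,K] = K; (iii) K is contained in every transitive normal subgroup of G. -/

import Mathlib

open Pointwise

def IsTransitiveOn {G : Type*} [Group G] (N : Subgroup G) (Ω : Type*) [MulAction G Ω] : Prop :=
  ∀ a b : Ω, ∃ n ∈ N, n • a = b

def IsSemiregularOn {G : Type*} [Group G] (N : Subgroup G) (Ω : Type*) [MulAction G Ω] : Prop :=
  ∀ n ∈ N, (∃ a : Ω, n • a = a) → n = 1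

def IsSemiprimitive (G Ω : Type*) [Group G] [MulAction G Ω] : Prop :=
  IsTransitiveOn (⊤ : Subgroup G) Ω ∧
    ∀ N : Subgroup G, N.Normal → IsTransitiveOn N Ω ∨ IsSemiregularOn N Ω

def IsPlinth {G : Type*} [Group G] (K : Subgroup G) (Ω : Type*) [MulAction G Ω] : Prop :=
  K.Normal ∧ IsTransitiveOn K Ω ∧
    ∀ N : Subgroup G, N.Normal → N < K → ¬ IsTransitiveOn N Ω

/-- The elements of `G` that fix every orbit of the subgroup `R` setwise. -/
def orbitKernel {G : Type*} [Group G] (R : Subgroup G) (Ω : Type*) [MulAction G Ω] :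
    Subgroup G where
  carrier := {g | ∀ b : Ω, ∃ r ∈ R, r • b = g • b}
  one_mem' b := ⟨1, R.one_mem, rfl⟩
  mul_mem' := by
    intro g h hg hh b
    obtain ⟨r, hr, hrb⟩ := hh b
    obtain ⟨s, hs, hsb⟩ := hg (h • b)
    exact ⟨s * r, R.mul_mem hs hr, by rw [mul_smul, hrb, hsb, mul_smul]⟩
  inv_mem' := by
    intro g hg b
    obtain ⟨r, hr, hrb⟩ := hg (g⁻¹ • b)
    exact ⟨r⁻¹, R.inv_mem hr, by rw [inv_smul_eq_iff, hrb, smul_inv_smul]⟩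

theorem mem_orbitKernel {G Ω : Type*} [Group G] [MulAction G Ω] {R : Subgroup G} {g : G} :
    g ∈ orbitKernel R Ω ↔ ∀ b : Ω, ∃ r ∈ R, r • b = g • b :=
  Iff.rfl

theorem orbitKernel_normal {G Ω : Type*} [Group G] [MulAction G Ω] {R : Subgroup G}
    (hR : R.Normal) : (orbitKernel R Ω).Normal where
  conj_mem := by
    intro g hg x b
    obtain ⟨r, hr, hrb⟩ := hg (x⁻¹ • b)
    exact ⟨x * r * x⁻¹, hR.conj_mem r hr x, by simp only [mul_smul, hrb]⟩

theorem IsTransitiveOn.of_orbitKernel {G Ω : Type*} [Group G] [MulAction G Ω] {R : Subgroup G}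
    (h : IsTransitiveOn (orbitKernel R Ω) Ω) : IsTransitiveOn R Ω := by
  intro a b
  obtain ⟨g, hg, rfl⟩ := h a b
  exact hg a

/-- In a semiprimitive group, the commutator of a normal subgroup that is not semiregular with a
transitive normal subgroup is transitive. -/
theorem IsSemiprimitive.isTransitiveOn_commutator {G Ω : Type*} [Group G] [MulAction G Ω]
    (hG : IsSemiprimitive G Ω) {K T : Subgroup G} (hK : K.Normal) (hT : T.Normal)
    (hnonreg : ¬ IsSemiregularOn K Ω) (htrans : IsTransitiveOn T Ω) :
    IsTransitiveOn ⁅K, T⁆ Ω := by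
  rcases hG.2 _ (orbitKernel_normal (Ω := Ω) (Subgroup.commutator_normal K T)) with h | h
  · exact h.of_orbitKernel
  · refine absurd ?_ hnonreg
    rintro k hk ⟨a, ha⟩
    refine h k (mem_orbitKernel.2 fun b => ?_) ⟨a, ha⟩
    obtain ⟨t, ht, rfl⟩ := htrans a b
    refine ⟨k * t * k⁻¹ * t⁻¹, Subgroup.commutator_mem_commutator hk ht, ?_⟩
    have hka : k⁻¹ • a = a := by rw [inv_smul_eq_iff, ha]
    simp only [mul_smul, inv_smul_smul, hka]

theorem IsPlinth.eq_of_le {G Ω : Type*} [Group G] [MulAction G Ω] {K N : Subgroup G}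
    (hK : IsPlinth K Ω) (hN : N.Normal) (hle : N ≤ K) (htrans : IsTransitiveOn N Ω) : N = K :=
  hle.eq_of_not_lt fun hlt => hK.2.2 N hN hlt htrans

/-- Let `G ≤ Sym(Ω)` be semiprimitive with a non-regular plinth `K`. Then `K` is the unique
plinth of `G`, `K` is perfect, and `K` is contained in every transitive normal subgroup. -/
theorem stmt5 {G Ω : Type*} [Group G] [MulAction G Ω] [FaithfulSMul G Ω]
    (hG : IsSemiprimitive G Ω) (K : Subgroup G) (hK : IsPlinth K Ω)
    (hnonreg : ∃ ω : Ω, ∃ k ∈ K, k ≠ 1 ∧ k • ω = ω) :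
    (∀ L : Subgroup G, IsPlinth L Ω → L = K) ∧
    ⁅K, K⁆ = K ∧
    (∀ T : Subgroup G, T.Normal → IsTransitiveOn T Ω → K ≤ T) := by
  have hKn : K.Normal := hK.1
  have hns : ¬ IsSemiregularOn K Ω := by
    obtain ⟨ω, k, hk, hk1, hkω⟩ := hnonreg
    exact fun h => hk1 (h k hk ⟨ω, hkω⟩)
  have hcomm : ∀ T : Subgroup G, T.Normal → IsTransitiveOn T Ω → ⁅K, T⁆ = K :=
    fun T hT htrans => hK.eq_of_le (Subgroup.commutator_normal K T)
      (Subgroup.commutator_le_left K T) (hG.isTransitiveOn_commutator hKn hT hns htrans)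
  have hle : ∀ T : Subgroup G, T.Normal → IsTransitiveOn T Ω → K ≤ T :=
    fun T hT htrans => (hcomm T hT htrans).ge.trans (Subgroup.commutator_le_right K T)
  exact ⟨fun L hL => (hL.eq_of_le hKn (hle L hL.1 hL.2.1) hK.2.1).symm,
    hcomm K hKn hK.2.1, hle⟩
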